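/- For the Salzmann operation ∗ on ℝ, every translation is strictly increasing: for each fixed t ∈ ℝ, the map x ↦ x ∗ t is a strictly increasing function from ℝ to ℝ. -/

import Mathlib

/-- The Salzmann operation on `ℝ`:
`x * t = x + t/2` if `x/t ≤ -3/2` or `x/t ≥ 1`,
`x * t = x/2 + t` if `-2/3 ≤ x/t ≤ 1`,
`x * t = 2x + 2t` if `-3/2 ≤ x/t ≤ -2/3`, and `x * 0 = x`.
(The clauses agree on the overlaps of the regions, so the nested `if`
below defines exactly this operation.) -/
noncomputable def salz (x t : ℝ) : ℝ :=
  if t = 0 then x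
  else if x / t ≤ -(3 / 2) ∨ 1 ≤ x / t then x + t / 2
  else if -(2 / 3) ≤ x / t then x / 2 + t
  else 2 * x + 2 * t

/-- every translation of the Salzmann operation is strictly
increasing. -/
theorem stmt_15 : ∀ t : ℝ, StrictMono (fun x => salz x t) := by
  intro t x y hxy
  rcases lt_trichotomy t 0 with ht | rfl | ht
  · simp only [salz, ht.ne, if_false, div_le_iff_of_neg ht, le_div_iff_of_neg ht]
    split_ifs <;> grind
  · simpa [salz] using hxy
  · simp only [salz, ht.ne', if_false, div_le_iff₀ ht, le_div_iff₀ ht]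
    split_ifs <;> grind
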